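/- arXiv:0909.4372 — 2 statements merged into one kernel-verified Lean document; each statement's English description precedes it below -/
import Mathlib

section
/- An O-family 𝒳 in ℝ^N is quasi-controllable if and only if for every nonzero x ∈ ℝ^N and every s ∈ 𝒮 (i.e., every natural number s with s + 1 ≥ N) one has span{𝒳(x, t, 0) : t ∈ ℕ, 0 ≤ t ≤ s} = ℝ^N. -/
open Set Filter Metric Pointwise

noncomputable section

variable {V : Type*} [NormedAddCommGroup V] [NormedSpace ℝ V]

/-- `famSet X u t s` is the set `𝒳(u, t, s) = {x(t) : x ∈ 𝒳, x(s) = u}`. -/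
def famSet (X : Set (ℕ → V)) (u : V) (t s : ℕ) : Set V :=
  {y | ∃ x ∈ X, x s = u ∧ x t = y}

/-- `𝒳` is an O-family: nonempty, satisfies the sewing condition, homogeneous,
time invariant, concave, locally bounded and continuous. -/
structure IsOFamily (X : Set (ℕ → V)) : Prop where
  nonempty : X.Nonempty
  sewing : ∀ ⦃t₁ t₂ t₃ : ℕ⦄, t₁ ≤ t₂ → t₂ ≤ t₃ → ∀ x ∈ X, ∀ y ∈ X, x t₂ = y t₂ →
    ∃ z ∈ X, (∀ t, t₁ ≤ t → t ≤ t₂ → z t = x t) ∧ (∀ t, t₂ ≤ t → t ≤ t₃ → z t = y t)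
  homog : ∀ (l : ℝ) (u : V) (t : ℕ), famSet X (l • u) t 0 = l • famSet X u t 0
  timeInv : ∀ (u : V) ⦃s t : ℕ⦄, s ≤ t → famSet X u t s = famSet X u (t - s) 0
  concave : ∀ ⦃l : ℝ⦄, 0 ≤ l → l ≤ 1 → ∀ (u v : V) (t : ℕ),
    famSet X (l • u + (1 - l) • v) t 0 ⊆ l • famSet X u t 0 + (1 - l) • famSet X v t 0
  locBdd : ∀ t : ℕ, ∃ ρ : ℝ, ∀ u : V, ‖u‖ = 1 → ∀ y ∈ famSet X u t 0, ‖y‖ ≤ ρ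
  contin : ∀ (u : ℕ → V) (u₀ : V), Tendsto u atTop (nhds u₀) → ∀ t : ℕ,
    Tendsto (fun n => hausdorffDist (famSet X (u n) t 0) (famSet X u₀ t 0)) atTop (nhds 0)

/-- Quasi-controllability: no nonzero proper linear subspace is invariant for `𝒳`. -/
def QuasiControllable (X : Set (ℕ → V)) : Prop :=
  ¬ ∃ E : Submodule ℝ V, E ≠ ⊥ ∧ E ≠ ⊤ ∧ ∀ x ∈ E, ∀ t : ℕ, famSet X x t 0 ⊆ (E : Set V)

/-- The absolutely convex hull `absco W = co (W ∪ (−W))`. -/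
def absco (W : Set V) : Set V := convexHull ℝ (W ∪ -W)

/-- The `s`-measure of quasi-controllability:
`qcm_s(𝒳) = inf_{‖x‖=1} sup {ρ ≥ 0 : ball of radius ρ ⊆ absco (⋃_{t ≤ s} 𝒳(x,t,0))}`. -/
def qcms (X : Set (ℕ → V)) (s : ℕ) : ℝ :=
  ⨅ x : {x : V // ‖x‖ = 1},
    sSup {ρ : ℝ | 0 ≤ ρ ∧ closedBall (0 : V) ρ ⊆ absco (⋃ t ≤ s, famSet X (x : V) t 0)}

/-- The quasi-controllability measure `qcm 𝒳 = sup_{s ∈ 𝒮} qcm_s 𝒳`,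
with `𝒮 = {s : dim V ≤ s + 1}`. -/
def qcm (X : Set (ℕ → V)) : ℝ :=
  ⨆ s : {s : ℕ // Module.finrank ℝ V ≤ s + 1}, qcms X (s : ℕ)

/-- Lyapunov stability of an O-family. -/
def LyapunovStable (X : Set (ℕ → V)) : Prop :=
  ∃ μ > (0 : ℝ), ∀ (x : V) (t : ℕ), ∀ u ∈ famSet X x t 0, ‖u‖ ≤ μ * ‖x‖

/-- The overshooting measure: the greatest lower bound of the Lyapunov stability constants. -/
def ovm (X : Set (ℕ → V)) : ℝ :=
  sInf {μ : ℝ | 0 < μ ∧ ∀ (x : V) (t : ℕ), ∀ u ∈ famSet X x t 0, ‖u‖ ≤ μ * ‖x‖}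

/-- Convergence of a sequence of O-families to an O-family. -/
def OFamTendsto (Xn : ℕ → Set (ℕ → V)) (X : Set (ℕ → V)) : Prop :=
  ∀ (x : V) (s : ℕ), Tendsto (fun n => ⨆ t : Fin (s + 1),
    hausdorffDist (closure (famSet (Xn n) x (t : ℕ) 0)) (closure (famSet X x (t : ℕ) 0)))
    atTop (nhds 0)

/-- Absolute exponential instability with exponent `ε`. -/
def AbsExpUnstable (X : Set (ℕ → V)) (ε : ℝ) : Prop :=
  ∃ γ > (0 : ℝ), ∀ u : V, ‖u‖ = 1 → ∃ x ∈ X, x 0 = u ∧ ∀ t : ℕ, γ * Real.exp (ε * t) ≤ ‖x t‖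

/-- Exponential stability of an O-family. -/
def ExpStable (X : Set (ℕ → V)) : Prop :=
  ∃ ε > (0 : ℝ), ∃ μ > (0 : ℝ), ∀ (x : V) (t : ℕ), ∀ u ∈ famSet X x t 0,
    ‖u‖ ≤ μ * Real.exp (-ε * t) * ‖x‖

end

section Helpers

variable {V : Type*} [NormedAddCommGroup V] [NormedSpace ℝ V]

lemma famSet_zero_eq {X : Set (ℕ → V)} (hO : IsOFamily X) (t : ℕ) : famSet X 0 t 0 = {0} := by
  obtain ⟨z, hz⟩ := hO.nonempty
  have h := hO.homog 0 (z 0) t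
  have hne : (famSet X (z 0) t 0).Nonempty := ⟨z t, z, hz, rfl, rfl⟩
  rw [zero_smul, Set.zero_smul_set hne] at h
  exact h

lemma exists_start {X : Set (ℕ → V)} (hO : IsOFamily X) (u : V) : ∃ z ∈ X, z 0 = u := by
  have h := hO.homog 0 u 0
  rw [zero_smul, famSet_zero_eq hO] at h
  have h2 : ((0 : ℝ) • famSet X u 0 0).Nonempty := by rw [← h]; simp
  obtain ⟨y, z, hz, hz0, -⟩ := Set.smul_set_nonempty.mp h2
  exact ⟨z, hz, hz0⟩

lemma famSet_add {X : Set (ℕ → V)} (hO : IsOFamily X) (u v : V) (t : ℕ) :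
    famSet X (u + v) t 0 ⊆ famSet X u t 0 + famSet X v t 0 := by
  have h := hO.concave (l := 1/2) (by norm_num) (by norm_num) ((2:ℝ) • u) ((2:ℝ) • v) t
  rw [← hO.homog, ← hO.homog] at h
  have e1 : ((1:ℝ)/2) • ((2:ℝ) • u) = u := by rw [smul_smul]; norm_num
  have e2 : (1 - (1:ℝ)/2) • ((2:ℝ) • v) = v := by rw [smul_smul]; norm_num
  rwa [e1, e2] at h

lemma famSet_succ {X : Set (ℕ → V)} (hO : IsOFamily X) {x y w : V} {t : ℕ}
    (hy : y ∈ famSet X x t 0) (hw : w ∈ famSet X y 1 0) : w ∈ famSet X x (t + 1) 0 := by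
  have h := hO.timeInv y (Nat.le_succ t)
  rw [Nat.succ_eq_add_one, Nat.add_sub_cancel_left] at h
  rw [← h] at hw
  obtain ⟨a, ha, ha0, hat⟩ := hy
  obtain ⟨b, hb, hbt, hbw⟩ := hw
  obtain ⟨z, hz, hz1, hz2⟩ := hO.sewing (Nat.zero_le t) (Nat.le_succ t) a ha b hb
    (by rw [hat, hbt])
  refine ⟨z, hz, ?_, ?_⟩
  · rw [hz1 0 le_rfl (Nat.zero_le t), ha0]
  · exact (hz2 (t+1) (Nat.le_succ t) le_rfl).trans hbw

def reachSpan (X : Set (ℕ → V)) (x : V) (s : ℕ) : Submodule ℝ V :=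
  Submodule.span ℝ (⋃ t ≤ s, famSet X x t 0)

lemma mem_reachSpan {X : Set (ℕ → V)} {x y : V} {s t : ℕ} (hts : t ≤ s)
    (hy : y ∈ famSet X x t 0) : y ∈ reachSpan X x s :=
  Submodule.subset_span (Set.mem_iUnion₂.mpr ⟨t, hts, hy⟩)

lemma reachSpan_mono (X : Set (ℕ → V)) (x : V) (s : ℕ) :
    reachSpan X x s ≤ reachSpan X x (s + 1) := by
  refine Submodule.span_le.mpr ?_
  intro y hy
  obtain ⟨t, ht, h⟩ := Set.mem_iUnion₂.mp hy
  exact mem_reachSpan (ht.trans (Nat.le_succ s)) h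

lemma step_mem {X : Set (ℕ → V)} (hO : IsOFamily X) (x : V) (s : ℕ) {y : V}
    (hy : y ∈ reachSpan X x s) :
    famSet X y 1 0 ⊆ (reachSpan X x (s + 1) : Set V) := by
  induction hy using Submodule.span_induction with
  | mem y hy =>
    obtain ⟨t, ht, h⟩ := Set.mem_iUnion₂.mp hy
    intro w hw
    exact mem_reachSpan (Nat.succ_le_succ ht) (famSet_succ hO h hw)
  | zero => rw [famSet_zero_eq hO]; simp
  | add u v _ _ hu hv =>
    intro w hw
    obtain ⟨a, ha, b, hb, rfl⟩ := famSet_add hO u v 1 hw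
    exact Submodule.add_mem _ (hu ha) (hv hb)
  | smul c u _ hu =>
    rw [hO.homog]
    rintro w ⟨a, ha, rfl⟩
    exact Submodule.smul_mem _ c (hu ha)

lemma invariant_of_eq {X : Set (ℕ → V)} (hO : IsOFamily X) (E : Submodule ℝ V)
    (h1 : ∀ y ∈ E, famSet X y 1 0 ⊆ (E : Set V)) :
    ∀ y ∈ E, ∀ t : ℕ, famSet X y t 0 ⊆ (E : Set V) := by
  intro y hy t
  induction t with
  | zero =>
    rintro w ⟨z, hz, h0, rfl⟩
    rw [h0]; exact hy
  | succ t ih =>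
    rintro w ⟨z, hz, h0, rfl⟩
    have hzt : z t ∈ E := ih ⟨z, hz, h0, rfl⟩
    have h := hO.timeInv (z t) (Nat.le_succ t)
    rw [Nat.succ_eq_add_one, Nat.add_sub_cancel_left] at h
    apply h1 _ hzt
    rw [← h]
    exact ⟨z, hz, rfl, rfl⟩

lemma reachSpan_dim [FiniteDimensional ℝ V] {X : Set (ℕ → V)} (hO : IsOFamily X)
    (hQ : QuasiControllable X) {x : V} (hx : x ≠ 0) (s : ℕ) :
    x ∈ reachSpan X x s ∧
    (reachSpan X x s = ⊤ ∨ s + 1 ≤ Module.finrank ℝ (reachSpan X x s)) := by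
  have hmem : ∀ s, x ∈ reachSpan X x s := by
    intro s
    obtain ⟨z, hz, h0⟩ := exists_start hO x
    exact mem_reachSpan (Nat.zero_le s) ⟨z, hz, h0, h0⟩
  have hbot : ∀ s, reachSpan X x s ≠ ⊥ := by
    intro s h
    have := hmem s
    rw [h, Submodule.mem_bot] at this
    exact hx this
  refine ⟨hmem s, ?_⟩
  induction s with
  | zero => exact Or.inr (Submodule.one_le_finrank_iff.mpr (hbot 0))
  | succ s ih =>
    by_cases htop : reachSpan X x s = ⊤
    · left
      have := reachSpan_mono X x s
      rw [htop] at this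
      exact top_le_iff.mp this
    · right
      have hlt : reachSpan X x s < reachSpan X x (s + 1) := by
        refine lt_of_le_of_ne (reachSpan_mono X x s) fun heq => hQ ?_
        refine ⟨reachSpan X x s, hbot s, htop, invariant_of_eq hO _ ?_⟩
        intro y hy
        have h := step_mem hO x s hy
        rwa [← heq] at h
      have := Submodule.finrank_lt_finrank_of_lt hlt
      have := ih.resolve_left htop
      omega

end Helpers

/-- An O-family `𝒳` in `ℝ^N` is quasi-controllable iff for every nonzero `x` and every
`s` with `s + 1 ≥ N`, the span of `⋃_{t ≤ s} 𝒳(x,t,0)` is all of `ℝ^N`. -/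
theorem quasiControllable_iff_span {N : ℕ} (hN : 1 ≤ N)
    (X : Set (ℕ → EuclideanSpace ℝ (Fin N))) (hO : IsOFamily X) :
    QuasiControllable X ↔
      ∀ x : EuclideanSpace ℝ (Fin N), x ≠ 0 → ∀ s : ℕ, N ≤ s + 1 →
        Submodule.span ℝ (⋃ t ≤ s, famSet X x t 0) = ⊤ := by
  constructor
  · intro hQ x hx s hs
    rcases (reachSpan_dim hO hQ hx s).2 with h | h
    · exact h
    · apply Submodule.eq_top_of_finrank_eq
      apply le_antisymm (Submodule.finrank_le _)
      rw [finrank_euclideanSpace_fin]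
      exact hs.trans h
  · rintro h ⟨E, hbot, htop, hE⟩
    obtain ⟨x, hxE, hx⟩ := Submodule.exists_mem_ne_zero_of_ne_bot hbot
    apply htop
    rw [← top_le_iff, ← h x hx N (Nat.le_succ N)]
    exact Submodule.span_le.mpr (Set.iUnion₂_subset fun t _ => hE x hxE t)
end

section
/- If a quasi-controllable O-family 𝒳 in ℝ^N is Lyapunov stable, then its overshooting measure satisfies ovm(𝒳) ≤ 1 / qcm(𝒳). -/
open Set Filter Metric Pointwise

section Helpers

variable {V : Type*} [NormedAddCommGroup V] [NormedSpace ℝ V]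

/-- `μ` is a Lyapunov stability constant. -/
def ValidC (X : Set (ℕ → V)) (μ : ℝ) : Prop :=
  0 < μ ∧ ∀ (x : V) (t : ℕ), ∀ u ∈ famSet X x t 0, ‖u‖ ≤ μ * ‖x‖

lemma famSet_nonempty {X : Set (ℕ → V)} (hO : IsOFamily X) (u : V) (t : ℕ) :
    (famSet X u t 0).Nonempty := by
  obtain ⟨x, hx⟩ := hO.nonempty
  have h1 := hO.homog 0 (x 0) t
  have h2 := hO.homog 0 u t
  have h3 : (famSet X (x 0) t 0).Nonempty := ⟨x t, x, hx, rfl, rfl⟩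
  have h4 : ((0 : ℝ) • famSet X (x 0) t 0).Nonempty := h3.smul_set
  rw [← h1, zero_smul] at h4
  rw [zero_smul] at h2
  rw [h2] at h4
  exact Set.smul_set_nonempty.1 h4

lemma famSet_smul {X : Set (ℕ → V)} (hO : IsOFamily X) (l : ℝ) {u y : V} {t : ℕ}
    (hy : y ∈ famSet X u t 0) : l • y ∈ famSet X (l • u) t 0 := by
  rw [hO.homog]
  exact Set.smul_mem_smul_set hy

lemma famSet_zero_time {X : Set (ℕ → V)} (hO : IsOFamily X) (u : V) :
    u ∈ famSet X u 0 0 := by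
  obtain ⟨y, x, hx, h0, h1⟩ := famSet_nonempty hO u 0
  exact ⟨x, hx, h0, h0⟩

lemma famSet_comp {X : Set (ℕ → V)} (hO : IsOFamily X) {x w y : V} {s t : ℕ}
    (hw : w ∈ famSet X x s 0) (hy : y ∈ famSet X w t 0) : y ∈ famSet X x (s + t) 0 := by
  have h := hO.timeInv w (Nat.le_add_right s t)
  rw [Nat.add_sub_cancel_left] at h
  rw [← h] at hy
  obtain ⟨a, ha, ha0, has⟩ := hw
  obtain ⟨b, hb, hbs, hbt⟩ := hy
  obtain ⟨z, hz, h1, h2⟩ := hO.sewing (Nat.zero_le s) (Nat.le_add_right s t) a ha b hb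
    (has.trans hbs.symm)
  exact ⟨z, hz, by rw [h1 0 le_rfl (Nat.zero_le s), ha0],
    by rw [h2 (s + t) (Nat.le_add_right s t) le_rfl, hbt]⟩

lemma convex_bound {X : Set (ℕ → V)} (hO : IsOFamily X) (M : ℝ) (t : ℕ) :
    Convex ℝ {z : V | ∀ y ∈ famSet X z t 0, ‖y‖ ≤ M} := by
  intro u hu v hv a b ha hb hab y hy
  have hb' : b = 1 - a := by linarith
  subst hb'
  obtain ⟨p, hp, q, hq, rfl⟩ := hO.concave ha (by linarith) u v t hy
  obtain ⟨p, hp, rfl⟩ := hp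
  obtain ⟨q, hq, rfl⟩ := hq
  have h1 := hu p hp
  have h2 := hv q hq
  calc ‖a • p + (1 - a) • q‖ ≤ ‖a • p‖ + ‖(1 - a) • q‖ := norm_add_le _ _
    _ = a * ‖p‖ + (1 - a) * ‖q‖ := by
        rw [norm_smul, norm_smul, Real.norm_of_nonneg ha, Real.norm_of_nonneg hb]
    _ ≤ a * M + (1 - a) * M := by gcongr
    _ = M := by ring

lemma absco_bound {X : Set (ℕ → V)} (hO : IsOFamily X) (M : ℝ) (t : ℕ) (W : Set V)
    (hW : ∀ w ∈ W, ∀ y ∈ famSet X w t 0, ‖y‖ ≤ M) :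
    ∀ z ∈ absco W, ∀ y ∈ famSet X z t 0, ‖y‖ ≤ M := by
  intro z hz
  refine convexHull_min ?_ (convex_bound hO M t) hz
  rintro w (hw | hw)
  · exact hW w hw
  · intro y hy
    have := hW (-w) hw (-y) (by simpa using famSet_smul hO (-1) hy)
    simpa using this

lemma absco_norm {X : Set (ℕ → V)} (hO : IsOFamily X) (M : ℝ) (W : Set V)
    (hW : ∀ w ∈ W, ‖w‖ ≤ M) {z : V} (hz : z ∈ absco W) : ‖z‖ ≤ M := by
  refine absco_bound hO M 0 W ?_ z hz z (famSet_zero_time hO z)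
  rintro w hw y ⟨x, -, h0, h1⟩
  rw [← h1, h0]
  exact hW w hw

lemma bdd_rho {X : Set (ℕ → V)} (hO : IsOFamily X) {μ : ℝ} (hμ : ValidC X μ) {x : V}
    (hx : ‖x‖ = 1) (s : ℕ) :
    BddAbove {ρ : ℝ | 0 ≤ ρ ∧ closedBall (0 : V) ρ ⊆ absco (⋃ t ≤ s, famSet X x t 0)} := by
  refine ⟨μ, ?_⟩
  rintro ρ ⟨h0, h⟩
  have h1 : ρ • x ∈ closedBall (0 : V) ρ := by
    simp [norm_smul, hx, abs_of_nonneg h0]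
  have h2 := absco_norm hO μ _ ?_ (h h1)
  · simpa [norm_smul, hx, abs_of_nonneg h0] using h2
  · intro w hw
    simp only [mem_iUnion] at hw
    obtain ⟨t, -, hw⟩ := hw
    simpa [hx] using hμ.2 x t w hw

lemma bdd_qcms {X : Set (ℕ → V)} (s : ℕ) :
    BddBelow (range fun x : {x : V // ‖x‖ = 1} =>
    sSup {ρ : ℝ | 0 ≤ ρ ∧ closedBall (0 : V) ρ ⊆ absco (⋃ t ≤ s, famSet X (x : V) t 0)}) := by
  refine ⟨0, ?_⟩
  rintro _ ⟨x, rfl⟩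
  exact Real.sSup_nonneg fun ρ h => h.1

lemma valid_zero {X : Set (ℕ → V)} {μ : ℝ} (hμ : ValidC X μ) {t : ℕ} {y : V}
    (hy : y ∈ famSet X 0 t 0) : y = 0 := by
  have := hμ.2 0 t y hy
  simpa using this

lemma valid_of_unit {X : Set (ℕ → V)} (hO : IsOFamily X) {μ : ℝ} (hμ : ValidC X μ) {K : ℝ}
    (hK : 0 < K) (h : ∀ x : V, ‖x‖ = 1 → ∀ t, ∀ u ∈ famSet X x t 0, ‖u‖ ≤ K) :
    ValidC X K := by
  refine ⟨hK, fun x t u hu => ?_⟩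
  by_cases hx : x = 0
  · subst hx
    simp [valid_zero hμ hu]
  · have hx' : 0 < ‖x‖ := norm_pos_iff.2 hx
    have h1 := h (‖x‖⁻¹ • x) (by rw [norm_smul, norm_inv, norm_norm, inv_mul_cancel₀ hx'.ne'])
      t _ (famSet_smul hO ‖x‖⁻¹ hu)
    rw [norm_smul, norm_inv, norm_norm, inv_mul_le_iff₀ hx'] at h1
    linarith

lemma valid_improve {X : Set (ℕ → V)} (hO : IsOFamily X) {μ : ℝ} (hμ : ValidC X μ) {x u : V}
    {t s : ℕ} {ρ : ℝ} (hx : ‖x‖ = 1) (hu : u ∈ famSet X x t 0) (hu0 : u ≠ 0) (hρ : 0 < ρ)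
    (h : closedBall (0 : V) ρ ⊆ absco (⋃ t ≤ s, famSet X (‖u‖⁻¹ • u) t 0)) :
    ValidC X (μ / (ρ * ‖u‖)) := by
  have hu' : 0 < ‖u‖ := norm_pos_iff.2 hu0
  refine valid_of_unit hO hμ (by have := hμ.1; positivity) ?_
  intro z hz r y hy
  have h1 : ρ • z ∈ closedBall (0 : V) ρ := by simp [norm_smul, hz, abs_of_pos hρ]
  have h2 := absco_bound hO (μ / ‖u‖) r _ ?_ _ (h h1) _ (famSet_smul hO ρ hy)
  · rw [norm_smul, Real.norm_of_nonneg hρ.le, le_div_iff₀ hu'] at h2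
    rw [le_div_iff₀ (by positivity)]
    linarith
  · intro w hw v hv
    simp only [mem_iUnion] at hw
    obtain ⟨t', -, hw⟩ := hw
    have h3 := famSet_smul hO ‖u‖ (famSet_comp hO hw hv)
    rw [smul_smul, mul_inv_cancel₀ hu'.ne', one_smul] at h3
    have h4 := hμ.2 _ _ _ (famSet_comp hO hu h3)
    rw [norm_smul, norm_norm, hx] at h4
    rw [le_div_iff₀ hu']
    linarith

lemma ovm_le_of_valid {X : Set (ℕ → V)} {μ : ℝ} (hμ : ValidC X μ) : ovm X ≤ μ :=
  csInf_le ⟨0, fun _ h => h.1.le⟩ hμ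

lemma le_ovm {X : Set (ℕ → V)} {μ c : ℝ} (hμ : ValidC X μ) (h : ∀ ν, ValidC X ν → c ≤ ν) :
    c ≤ ovm X :=
  le_csInf ⟨μ, hμ⟩ fun ν hν => h ν hν

lemma one_le_ovm {X : Set (ℕ → V)} (hO : IsOFamily X) {μ : ℝ} (hμ : ValidC X μ) {e : V}
    (he : ‖e‖ = 1) : 1 ≤ ovm X := by
  refine le_ovm hμ fun ν hν => ?_
  have := hν.2 e 0 e (famSet_zero_time hO e)
  simpa [he] using this

lemma norm_mul_qcms {X : Set (ℕ → V)} (hO : IsOFamily X) {μ : ℝ} (hμ : ValidC X μ) {x u : V}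
    {t : ℕ} (s : ℕ) (hx : ‖x‖ = 1) (hu : u ∈ famSet X x t 0) : ‖u‖ * qcms X s ≤ 1 := by
  by_cases hu0 : u = 0
  · simp [hu0]
  have hu' : 0 < ‖u‖ := norm_pos_iff.2 hu0
  have he : ‖‖u‖⁻¹ • u‖ = 1 := by rw [norm_smul, norm_inv, norm_norm, inv_mul_cancel₀ hu'.ne']
  have h1 := ciInf_le (bdd_qcms (X := X) s) ⟨_, he⟩
  have h2 : sSup {ρ : ℝ | 0 ≤ ρ ∧ closedBall (0 : V) ρ ⊆
      absco (⋃ t ≤ s, famSet X (‖u‖⁻¹ • u) t 0)} ≤ 1 / ‖u‖ := by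
    refine Real.sSup_le ?_ (by positivity)
    rintro ρ ⟨hρ, h⟩
    rcases hρ.eq_or_lt with rfl | hρ
    · positivity
    have ho := one_le_ovm hO hμ hx
    have h3 : ρ * ‖u‖ * ovm X ≤ ovm X := by
      refine le_ovm hμ fun ν hν => ?_
      have := ovm_le_of_valid (valid_improve hO hν hx hu hu0 hρ h)
      rw [le_div_iff₀ (by positivity)] at this
      linarith
    rw [le_div_iff₀ hu']
    by_contra hc
    push Not at hc
    nlinarith
  have h3 : qcms X s ≤ 1 / ‖u‖ := h1.trans h2
  rw [le_div_iff₀ hu'] at h3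
  linarith

lemma ovm_mul_qcms {X : Set (ℕ → V)} (hO : IsOFamily X) {μ : ℝ} (hμ : ValidC X μ) {e : V}
    (he : ‖e‖ = 1) (s : ℕ) : qcms X s ≤ 1 / ovm X := by
  have ho := one_le_ovm hO hμ he
  rcases le_or_gt (qcms X s) 0 with h | h
  · exact h.trans (by positivity)
  have h1 : ValidC X (1 / qcms X s) := by
    refine valid_of_unit hO hμ (by positivity) fun x hx t u hu => ?_
    rw [le_div_iff₀ h]
    exact norm_mul_qcms hO hμ s hx hu
  have h2 := ovm_le_of_valid h1
  rw [le_div_iff₀ h] at h2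
  rw [le_div_iff₀ (by linarith)]
  linarith

/-- Approximating points of `𝒳(x,t,0)` by points of `𝒳(x',t,0)`. -/
lemma approx {X : Set (ℕ → V)} (hO : IsOFamily X) {μ : ℝ} (hμ : ValidC X μ) {x x' y : V}
    {t : ℕ} (hy : y ∈ famSet X x t 0) {ε : ℝ} (hε : 0 < ε) :
    ∃ y' ∈ famSet X x' t 0,
      dist y y' < hausdorffDist (famSet X x' t 0) (famSet X x t 0) + ε := by
  have hb : ∀ x : V, Bornology.IsBounded (famSet X x t 0) := fun x =>
    (isBounded_closedBall (x := (0 : V)) (r := μ * ‖x‖)).subset fun u hu => by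
      simpa using hμ.2 x t u hu
  rw [hausdorffDist_comm]
  exact exists_dist_lt_of_hausdorffDist_lt hy (lt_add_of_pos_right _ hε)
    (hausdorffEDist_ne_top_of_nonempty_of_bounded (famSet_nonempty hO _ _)
      (famSet_nonempty hO _ _) (hb _) (hb _))

end Helpers

section Euclid

variable {V : Type*} [NormedAddCommGroup V] [InnerProductSpace ℝ V] [FiniteDimensional ℝ V]

lemma exists_sep (W : Set V) (hW : W.Nonempty) {r : ℝ} (hr : 0 < r)
    (h : ¬ closedBall (0 : V) r ⊆ absco W) :
    ∃ v : V, ‖v‖ = 1 ∧ ∀ w ∈ W, |inner ℝ v w| ≤ 2 * r := by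
  suffices H : ∃ v : V, v ≠ 0 ∧ ∀ w ∈ W, |inner ℝ v w| ≤ 2 * r * ‖v‖ by
    obtain ⟨v, hv, H⟩ := H
    have hv' : 0 < ‖v‖ := norm_pos_iff.2 hv
    refine ⟨‖v‖⁻¹ • v, by rw [norm_smul, norm_inv, norm_norm, inv_mul_cancel₀ hv'.ne'], ?_⟩
    intro w hw
    rw [real_inner_smul_left, abs_mul, abs_of_pos (by positivity), inv_mul_le_iff₀ hv']
    linarith [H w hw]
  have hsub : W ⊆ absco W := fun w hw => subset_convexHull ℝ _ (Or.inl hw)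
  have hsub' : -W ⊆ absco W := fun w hw => subset_convexHull ℝ _ (Or.inr hw)
  by_cases hspan : Submodule.span ℝ W = ⊤
  · have hconv : Convex ℝ (absco W) := convex_convexHull ℝ _
    have h0 : (0 : V) ∈ absco W := by
      obtain ⟨w, hw⟩ := hW
      have := hconv (hsub hw) (hsub' (by simpa using hw : -w ∈ -W))
        (by norm_num : (0 : ℝ) ≤ 1 / 2) (by norm_num : (0 : ℝ) ≤ 1 / 2) (by norm_num)
      simpa using this
    have hint : (interior (absco W)).Nonempty := by
      rw [hconv.interior_nonempty_iff_affineSpan_eq_top]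
      rw [eq_top_iff]
      intro z _
      have hz : z ∈ Submodule.span ℝ (absco W) :=
        Submodule.span_mono hsub (hspan ▸ Submodule.mem_top)
      have h1 := affineSpan_insert_zero (k := ℝ) (absco W)
      rw [insert_eq_of_mem h0] at h1
      show z ∈ (affineSpan ℝ (absco W) : Set V)
      rw [h1]
      exact hz
    rw [not_subset] at h
    obtain ⟨z, hz, hzn⟩ := h
    have hz2 : z ∉ interior (absco W) := fun hh => hzn (interior_subset hh)
    obtain ⟨f, hf⟩ := geometric_hahn_banach_open_point hconv.interior isOpen_interior hz2
    set v := (InnerProductSpace.toDual ℝ V).symm f with hv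
    have hfv : ∀ w, inner ℝ v w = f w := fun w => by
      rw [hv, InnerProductSpace.toDual_symm_apply]
    have hle : ∀ w ∈ absco W, f w ≤ f z := by
      have hcl : absco W ⊆ closure (interior (absco W)) := by
        rw [hconv.closure_interior_eq_closure_of_nonempty_interior hint]
        exact subset_closure
      have : closure (interior (absco W)) ⊆ {w | f w ≤ f z} :=
        closure_minimal (fun w hw => (hf w hw).le) (isClosed_le f.continuous continuous_const)
      exact fun w hw => this (hcl hw)
    refine ⟨v, ?_, ?_⟩
    · intro hv0
      obtain ⟨a, ha⟩ := hint
      have := hf a ha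
      rw [← hfv, ← hfv, hv0] at this
      simp at this
    · intro w hw
      have hz' : ‖z‖ ≤ r := by simpa using hz
      have hfz : f z ≤ 2 * r * ‖v‖ := by
        rw [← hfv]
        have h5 := real_inner_le_norm v z
        have := mul_le_mul_of_nonneg_left hz' (norm_nonneg v)
        nlinarith [norm_nonneg v]
      rw [hfv, abs_le]
      have h1 := hle w (hsub hw)
      have h2 := hle (-w) (hsub' (by simpa using hw))
      rw [map_neg] at h2
      constructor <;> linarith
  · have : (Submodule.span ℝ W)ᗮ ≠ ⊥ := fun hh => hspan (Submodule.orthogonal_eq_bot_iff.1 hh)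
    obtain ⟨v, hv, hv0⟩ := Submodule.exists_mem_ne_zero_of_ne_bot this
    refine ⟨v, hv0, fun w hw => ?_⟩
    rw [Submodule.inner_left_of_mem_orthogonal (Submodule.subset_span hw) hv, abs_zero]
    positivity

/-- The span of a reachable set is invariant. -/
lemma span_inv {X : Set (ℕ → V)} (hO : IsOFamily X) (x : V) :
    ∀ z ∈ Submodule.span ℝ (⋃ t, famSet X x t 0), ∀ r : ℕ,
      famSet X z r 0 ⊆ (Submodule.span ℝ (⋃ t, famSet X x t 0) : Set V) := by
  intro z hz r
  induction hz using Submodule.span_induction with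
  | mem w hw =>
    obtain ⟨t, hw⟩ := mem_iUnion.1 hw
    exact fun y hy => Submodule.subset_span (mem_iUnion.2 ⟨t + r, famSet_comp hO hw hy⟩)
  | zero =>
    have := hO.homog 0 (0 : V) r
    rw [zero_smul] at this
    rw [this]
    rintro _ ⟨y, -, rfl⟩
    simp
  | add a b _ _ iha ihb =>
    have h2 : a + b = (2 : ℝ) • ((1 / 2 : ℝ) • a + (1 - 1 / 2 : ℝ) • b) := by
      rw [smul_add, smul_smul, smul_smul]; norm_num
    rw [h2, hO.homog]
    rintro _ ⟨y, hy, rfl⟩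
    obtain ⟨p, ⟨p, hp, rfl⟩, q, ⟨q, hq, rfl⟩, rfl⟩ :=
      hO.concave (by norm_num) (by norm_num) a b r hy
    exact Submodule.smul_mem _ _ (Submodule.add_mem _ (Submodule.smul_mem _ _ (iha hp))
      (Submodule.smul_mem _ _ (ihb hq)))
  | smul c a _ iha =>
    rw [hO.homog]
    rintro _ ⟨y, hy, rfl⟩
    exact Submodule.smul_mem _ _ (iha hy)

lemma exists_uniform {X : Set (ℕ → V)} (hO : IsOFamily X) (hqc : QuasiControllable X) {μ : ℝ}
    (hμ : ValidC X μ) : ∃ n : ℕ, ∀ x : V, ‖x‖ = 1 →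
      closedBall (0 : V) (1 / ((n : ℝ) + 1)) ⊆ absco (⋃ t ≤ n, famSet X x t 0) := by
  by_contra! hcon
  choose x hx hnot using hcon
  have hsep := fun n => exists_sep (⋃ t ≤ n, famSet X (x n) t 0)
    ⟨x n, by simp only [mem_iUnion]; exact ⟨0, Nat.zero_le n, famSet_zero_time hO _⟩⟩
    (Nat.one_div_pos_of_nat (α := ℝ) (n := n)) (hnot n)
  choose v hv hvW using hsep
  obtain ⟨⟨x0, v0⟩, hmem, φ, hφ, hlim⟩ :=
    ((isCompact_sphere (0 : V) 1).prod (isCompact_sphere (0 : V) 1)).tendsto_subseq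
      (x := fun n => (x n, v n)) (fun n => by simp [hx, hv])
  have hx0 : ‖x0‖ = 1 := by simpa using hmem.1
  have hv0 : ‖v0‖ = 1 := by simpa using hmem.2
  have hlx : Tendsto (fun n => x (φ n)) atTop (nhds x0) :=
    (continuous_fst.tendsto _).comp hlim
  have hlv : Tendsto (fun n => v (φ n)) atTop (nhds v0) :=
    (continuous_snd.tendsto _).comp hlim
  have key : ∀ t, ∀ y ∈ famSet X x0 t 0, inner ℝ v0 y = 0 := by
    intro t y hy
    have hH := hO.contin _ _ hlx t
    have h1 : Tendsto (fun n => (1 : ℝ) / ((φ n : ℝ) + 1)) atTop (nhds 0) :=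
      tendsto_one_div_add_atTop_nhds_zero_nat.comp hφ.tendsto_atTop
    have hR : Tendsto (fun n => 2 * ((1 : ℝ) / ((φ n : ℝ) + 1)) +
        (hausdorffDist (famSet X (x (φ n)) t 0) (famSet X x0 t 0) + 1 / ((φ n : ℝ) + 1)))
        atTop (nhds 0) := by
      simpa using (h1.const_mul 2).add (hH.add h1)
    have hL : Tendsto (fun n => |inner ℝ (v (φ n)) y|) atTop (nhds |inner ℝ v0 y|) :=
      (hlv.inner tendsto_const_nhds).abs
    have hle : |inner ℝ v0 y| ≤ 0 := by
      refine le_of_tendsto_of_tendsto hL hR ?_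
      filter_upwards [eventually_ge_atTop t] with n hn
      obtain ⟨y', hy', hd⟩ := approx hO hμ (x' := x (φ n)) hy
        (Nat.one_div_pos_of_nat (α := ℝ) (n := φ n))
      have h2 := hvW (φ n) y' (by
        simp only [mem_iUnion]
        exact ⟨t, hn.trans (hφ.id_le n), hy'⟩)
      have h3 : inner ℝ (v (φ n)) y = inner ℝ (v (φ n)) y' + inner ℝ (v (φ n)) (y - y') := by
        rw [inner_sub_right]; ring
      have h4 := abs_real_inner_le_norm (v (φ n)) (y - y')
      rw [hv, one_mul, ← dist_eq_norm] at h4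
      rw [h3]
      refine (abs_add_le _ _).trans ?_
      linarith
    exact abs_nonpos_iff.1 hle
  refine hqc ⟨Submodule.span ℝ (⋃ t, famSet X x0 t 0), ?_, ?_, span_inv hO x0⟩
  · intro hbot
    have : x0 ∈ Submodule.span ℝ (⋃ t, famSet X x0 t 0) :=
      Submodule.subset_span (mem_iUnion.2 ⟨0, famSet_zero_time hO x0⟩)
    rw [hbot, Submodule.mem_bot] at this
    simp [this] at hx0
  · intro htop
    have hall : ∀ z ∈ Submodule.span ℝ (⋃ t, famSet X x0 t 0), inner ℝ v0 z = 0 := by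
      intro z hz
      have : Submodule.span ℝ (⋃ t, famSet X x0 t 0) ≤
          LinearMap.ker (innerSL ℝ v0 : V →ₗ[ℝ] ℝ) := by
        rw [Submodule.span_le]
        intro w hw
        obtain ⟨t, hw⟩ := mem_iUnion.1 hw
        simpa using key t w hw
      simpa using this hz
    have := hall v0 (htop ▸ Submodule.mem_top)
    rw [real_inner_self_eq_norm_sq, hv0] at this
    norm_num at this

lemma qcm_pos {X : Set (ℕ → V)} (hO : IsOFamily X) (hqc : QuasiControllable X) {μ : ℝ}
    (hμ : ValidC X μ) {e : V} (he : ‖e‖ = 1) : 0 < qcm X := by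
  obtain ⟨n, hn⟩ := exists_uniform hO hqc hμ
  set s := n + Module.finrank ℝ V with hs
  have hpos : (0 : ℝ) < 1 / ((n : ℝ) + 1) := Nat.one_div_pos_of_nat
  haveI : Nonempty {x : V // ‖x‖ = 1} := ⟨⟨e, he⟩⟩
  have h1 : 1 / ((n : ℝ) + 1) ≤ qcms X s := by
    refine le_ciInf fun x => le_csSup (bdd_rho hO hμ x.2 s) ⟨hpos.le, (hn x x.2).trans ?_⟩
    have hsub : (⋃ t ≤ n, famSet X (x : V) t 0) ⊆ ⋃ t ≤ s, famSet X (x : V) t 0 :=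
      biUnion_subset_biUnion_left fun t (ht : t ≤ n) => (by
        show t ≤ s
        omega)
    exact convexHull_mono (union_subset_union hsub (Set.neg_subset_neg.2 hsub))
  have h2 : qcms X s ≤ qcm X :=
    le_ciSup (f := fun s : {s : ℕ // Module.finrank ℝ V ≤ s + 1} => qcms X (s : ℕ))
      ⟨1 / ovm X, by rintro _ ⟨k, rfl⟩; exact ovm_mul_qcms hO hμ he k⟩ ⟨s, by omega⟩
  linarith

end Euclid

/-- If a quasi-controllable O-family `𝒳` is Lyapunov stable, then
`ovm 𝒳 ≤ 1 / qcm 𝒳`. -/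
theorem ovm_le_inv_qcm {N : ℕ} (hN : 1 ≤ N)
    (X : Set (ℕ → EuclideanSpace ℝ (Fin N))) (hO : IsOFamily X) (hqc : QuasiControllable X)
    (hst : LyapunovStable X) :
    ovm X ≤ 1 / qcm X := by
  obtain ⟨μ, hμ0, hμ1⟩ := hst
  have hμ : ValidC X μ := ⟨hμ0, hμ1⟩
  have he : ‖EuclideanSpace.single (⟨0, hN⟩ : Fin N) (1 : ℝ)‖ = 1 := by simp
  have hq := qcm_pos hO hqc hμ he
  have ho := one_le_ovm hO hμ he
  haveI : Nonempty {s : ℕ // Module.finrank ℝ (EuclideanSpace ℝ (Fin N)) ≤ s + 1} :=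
    ⟨⟨Module.finrank ℝ (EuclideanSpace ℝ (Fin N)), Nat.le_succ _⟩⟩
  have h : qcm X ≤ 1 / ovm X := ciSup_le fun s => ovm_mul_qcms hO hμ he s
  rw [le_div_iff₀ (by linarith)] at h
  rw [le_div_iff₀ hq]
  linarith
end
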